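/- For every sequence (s_n)_{n≥1} of natural numbers, there is a sequence of pairs (Q1^n, Q2^n) of finite ordered sets such that: (1) Q1^n is not order-isomorphic to Q2^n; (2) Q1^n and Q2^n have equal maximal decks and equal minimal decks; (3) there are ranks r_0,…,r_n such that Q1^n and Q2^n have equal marked rank r_i decks for each i, and the ranks r_1,…,r_n contain no maximal and no minimal elements; (4) for each rank k there is at least one element x of rank k in Q1^n and at least one element y of rank k in Q2^n such that Q1^n∖{x} and Q2^n∖{y} are order-isomorphic via a rank-preserving isomorphism; (5) for all the isomorphic cards Q1^n∖{x} and Q2^n∖{x} arising in (2)–(4), the neighborhoods ↕x in Q1^n and in Q2^n are order-isomorphic; (6) liminf_{n→∞} ECR(Q1^n, Q2^n) ≥ 1/10; (7) for every rank k, the rank k neighborhood decks of Q1^n and Q2^n are equal; (8) Q1^n and Q2^n have at least s_n maximal elements, at least s_n minimal elements, and for each rank r_i at least s_n elements of rank r_i. -/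

import Mathlib

/-- A finite ordered set: a type equipped with a partial order and a `Fintype` structure. -/
structure FinPoset where
  carrier : Type
  [po : PartialOrder carrier]
  [ft : Fintype carrier]

instance : CoeSort FinPoset Type := ⟨FinPoset.carrier⟩
attribute [instance] FinPoset.po FinPoset.ft

/-- The card of an ordered set obtained by deleting the point `x`,
as an induced subposet. -/
abbrev Card (P : Type*) [PartialOrder P] (x : P) : Type _ := {y : P // y ≠ x}

/-- The neighborhood `↕x = {y : y ≤ x or y ≥ x}` of a point `x`,
as an induced subposet. -/
abbrev Nbhd (P : Type*) [PartialOrder P] (x : P) : Type _ := {y : P // y ≤ x ∨ x ≤ y}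

/-- `P` and `P'` have equal marked maximal decks (via a correspondence under which,
in addition, the neighborhoods of corresponding removed points are isomorphic):
a bijection `σ` between the maximal elements such that each maximal card `P∖{m}` is
isomorphic to `P'∖{σ m}` via an isomorphism mapping maximal elements to maximal
elements, and `↕m ≅ ↕(σ m)`. -/
def EqualMarkedMaxDecksWithNbhds (P P' : Type*) [PartialOrder P] [PartialOrder P'] : Prop :=
  ∃ σ : {x : P // IsMax x} ≃ {y : P' // IsMax y},
    ∀ m : {x : P // IsMax x},
      (∃ Φ : Card P m.val ≃o Card P' (σ m).val,
        ∀ z : Card P m.val, IsMax z.val → IsMax (Φ z).val) ∧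
      Nonempty (Nbhd P m.val ≃o Nbhd P' (σ m).val)

/-- Equal marked minimal decks, with isomorphic neighborhoods of corresponding
removed points; dual to `EqualMarkedMaxDecksWithNbhds`. -/
def EqualMarkedMinDecksWithNbhds (P P' : Type*) [PartialOrder P] [PartialOrder P'] : Prop :=
  ∃ σ : {x : P // IsMin x} ≃ {y : P' // IsMin y},
    ∀ m : {x : P // IsMin x},
      (∃ Φ : Card P m.val ≃o Card P' (σ m).val,
        ∀ z : Card P m.val, IsMin z.val → IsMin (Φ z).val) ∧
      Nonempty (Nbhd P m.val ≃o Nbhd P' (σ m).val)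

/-- `P` and `P'` have equal marked rank `k` decks (via a correspondence under which,
in addition, the neighborhoods of corresponding removed points are isomorphic):
a bijection `σ` between the rank-`k` elements such that each card `P∖{x}` is
isomorphic to `P'∖{σ x}` via a rank-preserving isomorphism, and `↕x ≅ ↕(σ x)`.
(The rank of an element is `Order.height`.) -/
def EqualMarkedRankDecksWithNbhds (P P' : Type*) [PartialOrder P] [PartialOrder P']
    (k : ℕ) : Prop :=
  ∃ σ : {x : P // Order.height x = (k : ℕ∞)} ≃ {y : P' // Order.height y = (k : ℕ∞)},
    ∀ x : {x : P // Order.height x = (k : ℕ∞)},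
      (∃ Φ : Card P x.val ≃o Card P' (σ x).val,
        ∀ z : Card P x.val, Order.height (Φ z).val = Order.height z.val) ∧
      Nonempty (Nbhd P x.val ≃o Nbhd P' (σ x).val)

/-- `P` and `P'` have equal rank `k` neighborhood decks: a bijection `σ` between the
rank-`k` elements with `↕x ≅ ↕(σ x)` for every rank-`k` element `x`. -/
def EqualRankNbhdDecks (P P' : Type*) [PartialOrder P] [PartialOrder P'] (k : ℕ) : Prop :=
  ∃ σ : {x : P // Order.height x = (k : ℕ∞)} ≃ {y : P' // Order.height y = (k : ℕ∞)},
    ∀ x : {x : P // Order.height x = (k : ℕ∞)}, Nonempty (Nbhd P x.val ≃o Nbhd P' (σ x).val)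

/-- The equal card ratio `ECR(X, Y)`: the largest number `m` of pairwise distinct points
`x_1, …, x_m` of `X` and pairwise distinct points `y_1, …, y_m` of `Y` with
`X∖{x_i} ≅ Y∖{y_i}` for all `i`, divided by the number of elements of `X`. -/
noncomputable def ecr (X Y : FinPoset) : ℝ :=
  (sSup {m : ℕ | ∃ (f : Fin m ↪ ↥X) (g : Fin m ↪ ↥Y),
      ∀ i : Fin m, Nonempty (Card ↥X (f i) ≃o Card ↥Y (g i))} : ℕ) /
    (Fintype.card ↥X : ℕ)

/-- `P` and `P'` have equal maximal decks (via a correspondence under which, in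
addition, the neighborhoods of corresponding removed points are isomorphic). -/
def EqualMaxDecksWithNbhds (P P' : Type*) [PartialOrder P] [PartialOrder P'] : Prop :=
  ∃ σ : {x : P // IsMax x} ≃ {y : P' // IsMax y},
    ∀ m : {x : P // IsMax x},
      Nonempty (Card P m.val ≃o Card P' (σ m).val) ∧
      Nonempty (Nbhd P m.val ≃o Nbhd P' (σ m).val)

/-- `P` and `P'` have equal minimal decks (via a correspondence under which, in
addition, the neighborhoods of corresponding removed points are isomorphic). -/
def EqualMinDecksWithNbhds (P P' : Type*) [PartialOrder P] [PartialOrder P'] : Prop :=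
  ∃ σ : {x : P // IsMin x} ≃ {y : P' // IsMin y},
    ∀ m : {x : P // IsMin x},
      Nonempty (Card P m.val ≃o Card P' (σ m).val) ∧
      Nonempty (Nbhd P m.val ≃o Nbhd P' (σ m).val)

namespace FoldedPair

/-- Block indices: the band together with the position inside the band. -/
abbrev Idx (n s : ℕ) := Fin (n + 1) × Fin (4 * s + 8)

/-- The elements: every block consists of four elements, which carry an incoming and an
outgoing bit, and every block has a pin. The parameter `τ` records the twist of the order. -/
inductive El (n s : ℕ) (τ : Bool)
  | pin (k : Idx n s)
  | blk (k : Idx n s) (i o : Bool)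

variable {n s : ℕ} {τ : Bool}

/-- The elements as a sum type. -/
def elEquiv (n s : ℕ) (τ : Bool) : El n s τ ≃ Idx n s ⊕ (Idx n s × Bool × Bool) where
  toFun
    | .pin k => Sum.inl k
    | .blk k i o => Sum.inr (k, i, o)
  invFun
    | Sum.inl k => .pin k
    | Sum.inr (k, i, o) => .blk k i o
  left_inv x := by cases x <;> rfl
  right_inv x := by rcases x with k | ⟨k, i, o⟩ <;> rfl

instance : Fintype (El n s τ) := Fintype.ofEquiv _ (elEquiv n s τ).symm

lemma card_el : Fintype.card (El n s τ) = 5 * Fintype.card (Idx n s) := by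
  rw [Fintype.card_congr (elEquiv n s τ)]
  simp only [Fintype.card_sum, Fintype.card_prod, Fintype.card_bool]
  ring

lemma sum_el {M : Type*} [AddCommMonoid M] (f : El n s τ → M) :
    ∑ x, f x = ∑ k, f (.pin k) + ∑ k, ∑ i, ∑ o, f (.blk k i o) := by
  rw [← (elEquiv n s τ).symm.sum_comp f, Fintype.sum_sum_type]
  simp only [Fintype.sum_prod_type]
  rfl

/-- The level of the pin of a block. -/
def pinLvl (k : Idx n s) : ℕ :=
  if 4 * s + 4 ≤ k.2.val then 3 * k.1.val + 2 - k.2.val % 2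
  else 3 * k.1.val + 3 * (k.2.val % 2)

/-- The level of an element, which turns out to be its rank. -/
def lvl : El n s τ → ℕ
  | .pin k => pinLvl k
  | .blk k _ _ => 3 * k.1.val + 1 + k.2.val % 2

/-- The block `k'` follows the block `k`. -/
def Next (k k' : Idx n s) : Prop :=
  (k'.1.val = k.1.val ∧ k'.2.val = k.2.val + 1) ∨
    (k'.1.val = k.1.val + 1 ∧ k.2.val = 4 * s + 7 ∧ k'.2.val = 0)

/-- The elements of a block that are incomparable to the pin of the block. -/
def mark (τ : Bool) (k : Idx n s) (i o : Bool) : Bool :=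
  if k.1.val = 0 ∧ k.2.val = 0 then o ^^ τ
  else if k.1.val = n ∧ k.2.val = 4 * s + 7 then i
  else i ^^ o

/-- Incomparability of the pin of block `k` and an element of block `k'`. -/
def PinEx (τ : Bool) (k k' : Idx n s) (i o : Bool) : Prop :=
  (k = k' ∧ mark τ k i o = true) ∨
    (k'.2.val = 4 * s + 7 ∧ k'.1.val < n ∧ pinLvl k = 3 * k'.1.val + 3)

/-- Incomparability of elements of different levels. -/
def Ex : El n s τ → El n s τ → Prop
  | .pin _, .pin _ => False
  | .pin k, .blk k' i o => PinEx τ k k' i o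
  | .blk k' i o, .pin k => PinEx τ k k' i o
  | .blk k i o, .blk k' i' o' => (Next k k' ∧ o ≠ i') ∨ (Next k' k ∧ o' ≠ i)

lemma ex_symm {x y : El n s τ} (h : Ex x y) : Ex y x := by
  rcases x with k | ⟨k, i, o⟩ <;> rcases y with k' | ⟨k', i', o'⟩ <;> simp only [Ex] at h ⊢
  · exact h
  · exact h
  · exact h.symm

lemma ex_comm {x y : El n s τ} : Ex x y ↔ Ex y x := ⟨ex_symm, ex_symm⟩

lemma lvl_ne_of_ex {x y : El n s τ} (h : Ex x y) : lvl x ≠ lvl y := by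
  have key : ∀ (k k' : Idx n s) (i o : Bool), PinEx τ k k' i o →
      pinLvl k ≠ 3 * k'.1.val + 1 + k'.2.val % 2 := by
    rintro k k' i o (⟨rfl, -⟩ | ⟨h1, h2, h3⟩)
    · unfold pinLvl; split_ifs <;> omega
    · omega
  rcases x with k | ⟨k, i, o⟩ <;> rcases y with k' | ⟨k', i', o'⟩ <;> simp only [Ex, lvl] at h ⊢
  · exact key _ _ _ _ h
  · exact (key _ _ _ _ h).symm
  · unfold Next at h; omega

lemma exists_pin_of_lvl {x : El n s τ} {b : ℕ} (h : lvl x = 3 * b) : ∃ k, x = .pin k := by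
  rcases x with k | ⟨k, i, o⟩
  · exact ⟨k, rfl⟩
  · simp only [lvl] at h; omega

lemma ex_trans {x y z : El n s τ} (hxy : lvl x < lvl y) (hyz : lvl y < lvl z) (h : Ex x z) :
    Ex x y ∨ Ex y z := by
  have key : ∀ (k k' : Idx n s) (i o : Bool), PinEx τ k k' i o →
      pinLvl k ≤ 3 * k'.1.val + 1 + k'.2.val % 2 + 1 ∧
      3 * k'.1.val + 1 + k'.2.val % 2 ≤ pinLvl k + 1 := by
    rintro k k' i o (⟨rfl, -⟩ | ⟨h1, h2, h3⟩)
    · unfold pinLvl; split_ifs <;> omega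
    · omega
  rcases x with k | ⟨k, i, o⟩ <;> rcases z with k' | ⟨k', i', o'⟩
  · exact h.elim
  · have := key _ _ _ _ h
    simp only [lvl] at hxy hyz this
    omega
  · have := key _ _ _ _ h
    simp only [lvl] at hxy hyz this
    omega
  · have hk : k.2.val = 4 * s + 7 ∧ k.1.val < n ∧ lvl y = 3 * (k.1.val + 1) := by
      have := k'.1.isLt
      simp only [Ex, Next, lvl] at h hxy hyz ⊢
      omega
    obtain ⟨l, rfl⟩ := exists_pin_of_lvl hk.2.2
    exact Or.inl (Or.inr ⟨hk.1, hk.2.1, hk.2.2⟩)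

instance : PartialOrder (El n s τ) where
  le x y := x = y ∨ (lvl x < lvl y ∧ ¬ Ex x y)
  le_refl x := Or.inl rfl
  le_trans x y z := by
    rintro (rfl | ⟨h1, h2⟩) (rfl | ⟨h3, h4⟩)
    · exact Or.inl rfl
    · exact Or.inr ⟨h3, h4⟩
    · exact Or.inr ⟨h1, h2⟩
    · exact Or.inr ⟨h1.trans h3, fun h => (ex_trans h1 h3 h).elim h2 h4⟩
  le_antisymm x y := by
    rintro (rfl | ⟨h1, h2⟩) (h | ⟨h3, h4⟩)
    · rfl
    · rfl
    · exact h.symm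
    · omega

lemma le_iff {x y : El n s τ} : x ≤ y ↔ x = y ∨ (lvl x < lvl y ∧ ¬ Ex x y) := Iff.rfl

lemma lt_iff {x y : El n s τ} : x < y ↔ lvl x < lvl y ∧ ¬ Ex x y := by
  rw [lt_iff_le_and_ne, le_iff]
  constructor
  · rintro ⟨rfl | h, h'⟩
    · exact absurd rfl h'
    · exact h
  · intro h
    exact ⟨Or.inr h, fun e => by subst e; exact lt_irrefl _ h.1⟩

lemma lvl_le (x : El n s τ) : lvl x ≤ 3 * n + 3 := by
  rcases x with k | ⟨k, i, o⟩ <;> have := k.1.isLt <;> simp only [lvl, pinLvl]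
  · split_ifs <;> omega
  · omega

/-- Every level contains two pins. -/
lemma exists_two_pins (l : ℕ) (hl : l ≤ 3 * n + 3) :
    ∃ k k' : Idx n s, k ≠ k' ∧ pinLvl k = l ∧ pinLvl k' = l := by
  obtain h | h : l = 3 * n + 3 ∨ l < 3 * n + 3 := by omega
  · refine ⟨(⟨n, by omega⟩, ⟨1, by omega⟩), (⟨n, by omega⟩, ⟨3, by omega⟩), ?_, ?_, ?_⟩
    · simp
    · simp only [pinLvl]; split_ifs <;> omega
    · simp only [pinLvl]; split_ifs <;> omega
  · obtain h0 | h0 | h0 : l % 3 = 0 ∨ l % 3 = 1 ∨ l % 3 = 2 := by omega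
    · refine ⟨(⟨l / 3, by omega⟩, ⟨0, by omega⟩), (⟨l / 3, by omega⟩, ⟨2, by omega⟩), ?_, ?_, ?_⟩
      · simp
      · simp only [pinLvl]; split_ifs <;> omega
      · simp only [pinLvl]; split_ifs <;> omega
    · refine ⟨(⟨l / 3, by omega⟩, ⟨4 * s + 7, by omega⟩),
        (⟨l / 3, by omega⟩, ⟨4 * s + 5, by omega⟩), ?_, ?_, ?_⟩
      · simp
      · simp only [pinLvl]; split_ifs <;> omega
      · simp only [pinLvl]; split_ifs <;> omega
    · refine ⟨(⟨l / 3, by omega⟩, ⟨4 * s + 6, by omega⟩),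
        (⟨l / 3, by omega⟩, ⟨4 * s + 4, by omega⟩), ?_, ?_, ?_⟩
      · simp
      · simp only [pinLvl]; split_ifs <;> omega
      · simp only [pinLvl]; split_ifs <;> omega

/-- Unless the level `l` is right above the elements of the block of `x`, some pin of level `l`
is comparable to `x`. -/
lemma exists_pin_not_ex (x : El n s τ) (l : ℕ) (hl : l ≤ 3 * n + 3)
    (hx : ∀ k i o, x = .blk k i o → k.1.val < n → l ≠ 3 * k.1.val + 3) :
    ∃ k : Idx n s, pinLvl k = l ∧ ¬ Ex x (.pin k) := by
  obtain ⟨k, k', hne, hk, hk'⟩ := exists_two_pins (s := s) l hl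
  rcases x with y | ⟨y, i, o⟩
  · exact ⟨k, hk, id⟩
  · have hy := hx y i o rfl
    by_cases h : k = y
    · refine ⟨k', hk', ?_⟩
      rintro (⟨h1, -⟩ | ⟨-, h2, h3⟩)
      · exact hne (h.trans h1.symm)
      · exact hy h2 (hk' ▸ h3)
    · refine ⟨k, hk, ?_⟩
      rintro (⟨h1, -⟩ | ⟨-, h2, h3⟩)
      · exact h h1
      · exact hy h2 (hk ▸ h3)

lemma exists_lt_of_lvl (x : El n s τ) (h : lvl x ≠ 0) : ∃ y, y < x ∧ lvl y + 1 = lvl x := by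
  have hle := lvl_le x
  by_cases hx : ∃ b, lvl x = 3 * b
  · obtain ⟨b, hb⟩ := hx
    obtain ⟨k, rfl⟩ := exists_pin_of_lvl hb
    have hb' : b - 1 < n + 1 := by omega
    refine ⟨.blk (⟨b - 1, hb'⟩, ⟨1, by omega⟩) false false, ?_, ?_⟩
    · rw [lt_iff]
      refine ⟨by simp only [lvl] at *; omega, ?_⟩
      rintro (⟨h0, h1⟩ | ⟨h1, -⟩)
      · simp [h0, mark] at h1
      · simp at h1
    · simp only [lvl] at *; omega
  · push Not at hx
    obtain ⟨k, hk, hk'⟩ := exists_pin_not_ex x (lvl x - 1) (by omega) (by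
      rintro k i o rfl - h
      simp only [lvl] at h
      omega)
    refine ⟨.pin k, lt_iff.2 ⟨?_, fun h => hk' (ex_symm h)⟩, ?_⟩ <;> simp only [lvl] at * <;> omega

lemma isMax_iff {x : El n s τ} : IsMax x ↔ lvl x = 3 * n + 3 := by
  have hle := lvl_le x
  constructor
  · intro h
    by_contra hne
    obtain ⟨k, hk, hk'⟩ := exists_pin_not_ex x (3 * n + 3) le_rfl (by
      rintro k i o rfl h; omega)
    exact h.not_lt (lt_iff.2 ⟨by simp only [lvl] at *; omega, hk'⟩)
  · intro h
    rw [isMax_iff_forall_not_lt]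
    intro y hy
    have := (lt_iff.1 hy).1
    have := lvl_le y
    omega

lemma isMin_iff {x : El n s τ} : IsMin x ↔ lvl x = 0 := by
  constructor
  · intro h
    by_contra hne
    obtain ⟨y, hy, -⟩ := exists_lt_of_lvl x hne
    exact h.not_lt hy
  · intro h
    rw [isMin_iff_forall_not_lt]
    intro y hy
    have := (lt_iff.1 hy).1
    omega

lemma height_eq (x : El n s τ) : Order.height x = (lvl x : ℕ∞) := by
  have hmono : StrictMono (lvl : El n s τ → ℕ) := fun x y h => (lt_iff.1 h).1
  apply le_antisymm
  · simpa using Order.height_le_height_apply_of_strictMono _ hmono x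
  · induction hl : lvl x generalizing x with
    | zero => simp
    | succ l ih =>
      obtain ⟨y, hy, hyl⟩ := exists_lt_of_lvl x (by omega)
      have h1 := ih y (by omega)
      have h2 := Order.height_add_one_le hy
      push_cast
      exact (add_le_add_left h1 1).trans h2

lemma height_eq_iff {x : El n s τ} {k : ℕ} : Order.height x = (k : ℕ∞) ↔ lvl x = k := by
  rw [height_eq, Nat.cast_inj]

/-- The block `k` lies strictly before the block `y`. -/
def before (y k : Idx n s) : Bool :=
  decide (k.1.val < y.1.val ∨ (k.1.val = y.1.val ∧ k.2.val < y.2.val))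

lemma mark_flip {y k : Idx n s} (h : k ≠ y) (σ : Bool) (i o : Bool) :
    mark (!σ) k (i ^^ !before k y) (o ^^ before y k) = mark σ k i o := by
  have hne : ¬ (k.1.val = y.1.val ∧ k.2.val = y.2.val) := fun h' =>
    h (Prod.ext (Fin.ext h'.1) (Fin.ext h'.2))
  have hy1 := y.1.isLt
  have hy2 := y.2.isLt
  unfold mark
  split_ifs with h1 h2
  · have : before y k = true := by
      simp only [before, decide_eq_true_eq]; omega
    rw [this]; cases o <;> cases σ <;> rfl
  · have : before k y = true := by
      simp only [before, decide_eq_true_eq]; omega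
    rw [this]; cases i <;> rfl
  · have : before y k = !before k y := by
      rw [Bool.eq_iff_iff]
      simp only [before, Bool.not_eq_true', decide_eq_true_eq, decide_eq_false_iff_not]; omega
    rw [this]; cases i <;> cases o <;> cases before k y <;> rfl

lemma before_of_next {y k k' : Idx n s} (h : Next k k') : before y k = !before k' y := by
  have hy2 := y.2.isLt
  have hk2 := k.2.isLt
  have hk2' := k'.2.isLt
  rw [Bool.eq_iff_iff]
  simp only [before, Bool.not_eq_true', decide_eq_true_eq, decide_eq_false_iff_not]
  unfold Next at h
  omega

/-- Flipping all the bits before the pin of the block `y`. -/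
def flipFun (y : Idx n s) (τ τ' : Bool) : El n s τ → El n s τ'
  | .pin k => .pin k
  | .blk k i o => .blk k (i ^^ !before k y) (o ^^ before y k)

lemma flipFun_flipFun (y : Idx n s) (τ' : Bool) (x : El n s τ) :
    flipFun y τ' τ (flipFun y τ τ' x) = x := by
  cases x <;> simp [flipFun]

/-- `flipFun` as an equivalence. -/
def flip (y : Idx n s) (τ τ' : Bool) : El n s τ ≃ El n s τ' where
  toFun := flipFun y τ τ'
  invFun := flipFun y τ' τ
  left_inv := flipFun_flipFun y τ'
  right_inv := flipFun_flipFun y τ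

lemma flip_pin (y k : Idx n s) (τ τ' : Bool) : flip y τ τ' (.pin k) = .pin k := rfl

lemma lvl_flip (y : Idx n s) (τ' : Bool) (x : El n s τ) : lvl (flip y τ τ' x) = lvl x := by
  cases x <;> rfl

lemma pinEx_flip {y k : Idx n s} (h : k ≠ y) (σ : Bool) (k' : Idx n s) (i o : Bool) :
    PinEx (!σ) k k' (i ^^ !before k' y) (o ^^ before y k') ↔ PinEx σ k k' i o := by
  unfold PinEx
  refine or_congr (and_congr_right ?_) Iff.rfl
  rintro rfl
  rw [mark_flip h]

lemma ex_flip {y : Idx n s} {x z : El n s τ} (hx : x ≠ .pin y) (hz : z ≠ .pin y) :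
    Ex (flip y τ (!τ) x) (flip y τ (!τ) z) ↔ Ex x z := by
  rcases x with k | ⟨k, i, o⟩ <;> rcases z with k' | ⟨k', i', o'⟩
  · exact Iff.rfl
  · exact pinEx_flip (fun h => hx (congrArg El.pin h)) _ _ _ _
  · exact pinEx_flip (fun h => hz (congrArg El.pin h)) _ _ _ _
  · refine or_congr (and_congr_right fun h => ?_) (and_congr_right fun h => ?_)
    · rw [before_of_next h]
      cases o <;> cases i' <;> cases before k' y <;> decide
    · rw [before_of_next h]
      cases o' <;> cases i <;> cases before k y <;> decide

lemma flip_le_flip {y : Idx n s} {x z : El n s τ} (hx : x ≠ .pin y) (hz : z ≠ .pin y) :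
    flip y τ (!τ) x ≤ flip y τ (!τ) z ↔ x ≤ z := by
  rw [le_iff, le_iff, ex_flip hx hz, lvl_flip, lvl_flip, (flip y τ (!τ)).injective.eq_iff]

/-- The cards obtained by removing a pin are isomorphic. -/
def cardIso (y : Idx n s) (τ : Bool) :
    Card (El n s τ) (.pin y) ≃o Card (El n s (!τ)) (.pin y) where
  toEquiv := (flip y τ (!τ)).subtypeEquiv fun x => by
    rw [← flip_pin y y τ (!τ), (flip y τ (!τ)).injective.ne_iff]
  map_rel_iff' {x z} := flip_le_flip x.2 z.2

lemma height_cardIso (y : Idx n s) (z : Card (El n s τ) (.pin y)) :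
    Order.height (cardIso y τ z).val = Order.height z.val := by
  rw [height_eq, height_eq]
  exact congrArg _ (lvl_flip y _ z.val)

lemma ne_of_mem_nbhd {x y z : El n s τ} (hl : lvl x = lvl y) (hxy : x ≠ y)
    (hz : z ≤ x ∨ x ≤ z) : z ≠ y := by
  rintro rfl
  rcases hz with (h | h) | (h | h)
  · exact hxy h.symm
  · exact h.1.ne' hl
  · exact hxy h
  · exact h.1.ne hl

lemma nonempty_nbhd_iso {y : Idx n s} {x : El n s τ} (hl : lvl x = pinLvl y) (hx : x ≠ .pin y) :
    Nonempty (Nbhd (El n s τ) x ≃o Nbhd (El n s (!τ)) (flip y τ (!τ) x)) := by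
  have key : ∀ z w : El n s τ, z ≠ .pin y → w ≠ .pin y →
    (flip y τ (!τ) z ≤ flip y τ (!τ) w ↔ z ≤ w) := fun z w => flip_le_flip
  refine ⟨⟨(flip y τ (!τ)).subtypeEquiv fun z => ?_, fun {z w} => ?_⟩⟩
  · by_cases hz : z = .pin y
    · subst hz
      have h1 : ¬ ((El.pin y : El n s τ) ≤ x ∨ x ≤ .pin y) :=
        fun h => ne_of_mem_nbhd (y := .pin y) hl hx h rfl
      have h2 : ¬ ((El.pin y : El n s (!τ)) ≤ flip y τ (!τ) x ∨ flip y τ (!τ) x ≤ .pin y) :=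
        fun h => ne_of_mem_nbhd (y := .pin y) ((lvl_flip y _ x).trans hl)
          (fun e => hx ((flip y τ (!τ)).injective e)) h rfl
      exact iff_of_false h1 h2
    · rw [key _ _ hz hx, key _ _ hx hz]
  · exact flip_le_flip (ne_of_mem_nbhd (y := .pin y) hl hx z.2)
      (ne_of_mem_nbhd (y := .pin y) hl hx w.2)

lemma nonempty_nbhd_pin_iso (y : Idx n s) :
    Nonempty (Nbhd (El n s τ) (.pin y) ≃o Nbhd (El n s (!τ)) (.pin y)) := by
  obtain ⟨k, k', hne, hk, hk'⟩ := exists_two_pins (s := s) (pinLvl y) (lvl_le (τ := τ) (.pin y))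
  by_cases h : y = k
  · exact nonempty_nbhd_iso (y := k') (x := .pin y) hk'.symm
      (fun e => hne (h.symm.trans (El.pin.inj e)))
  · exact nonempty_nbhd_iso (y := k) (x := .pin y) hk.symm (fun e => h (El.pin.inj e))

/-- Away from the pins, a flip induces isomorphisms of neighborhoods; at the pins the
identification of the pins does. -/
lemma equalRankNbhdDecks (k : ℕ) : EqualRankNbhdDecks (El n s τ) (El n s (!τ)) k := by
  by_cases hk : k ≤ 3 * n + 3
  · obtain ⟨y, -, -, hy, -⟩ := exists_two_pins (s := s) k hk
    refine ⟨(flip y τ (!τ)).subtypeEquiv fun x => ?_, fun x => ?_⟩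
    · rw [height_eq_iff, height_eq_iff, lvl_flip]
    · by_cases hx : x.val = .pin y
      · obtain ⟨x, h⟩ := x
        subst hx
        exact nonempty_nbhd_pin_iso y
      · exact nonempty_nbhd_iso ((height_eq_iff.1 x.2).trans hy.symm) hx
  · have h : ∀ (σ : Bool) (x : El n s σ), Order.height x ≠ (k : ℕ∞) := fun σ x hx =>
      hk (height_eq_iff.1 hx ▸ lvl_le x)
    have : IsEmpty {x : El n s τ // Order.height x = (k : ℕ∞)} := ⟨fun x => h _ _ x.2⟩
    have : IsEmpty {x : El n s (!τ) // Order.height x = (k : ℕ∞)} := ⟨fun x => h _ _ x.2⟩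
    exact ⟨Equiv.equivOfIsEmpty _ _, fun x => isEmptyElim x⟩

/-- The identity on the elements. -/
def ident (n s : ℕ) (τ τ' : Bool) : El n s τ ≃ El n s τ' :=
  (elEquiv n s τ).trans (elEquiv n s τ').symm

lemma lvl_ident (τ' : Bool) (x : El n s τ) : lvl (ident n s τ τ' x) = lvl x := by
  cases x <;> rfl

/-- On a level consisting of pins only, all cards and neighborhoods agree. -/
lemma exists_equiv_of_lvl {p : El n s τ → Prop} {q : El n s (!τ) → Prop} (b : ℕ)
    (hp : ∀ x, p x ↔ lvl x = 3 * b) (hq : ∀ x, q x ↔ lvl x = 3 * b) :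
    ∃ σ : {x // p x} ≃ {y // q y}, ∀ x : {x // p x},
      (∃ Φ : Card (El n s τ) x.val ≃o Card (El n s (!τ)) (σ x).val,
        ∀ z : Card (El n s τ) x.val, Order.height (Φ z).val = Order.height z.val) ∧
      Nonempty (Nbhd (El n s τ) x.val ≃o Nbhd (El n s (!τ)) (σ x).val) := by
  refine ⟨(ident n s τ (!τ)).subtypeEquiv fun x => ?_, fun x => ?_⟩
  · rw [hp, hq, lvl_ident]
  · obtain ⟨x, hx⟩ := x
    obtain ⟨k, rfl⟩ := exists_pin_of_lvl ((hp x).1 hx)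
    exact ⟨⟨cardIso k τ, height_cardIso k⟩, nonempty_nbhd_pin_iso k⟩

lemma equalMarkedRankDecks (b : ℕ) :
    EqualMarkedRankDecksWithNbhds (El n s τ) (El n s (!τ)) (3 * b) :=
  exists_equiv_of_lvl b (fun _ => height_eq_iff) (fun _ => height_eq_iff)

lemma equalMaxDecks : EqualMaxDecksWithNbhds (El n s τ) (El n s (!τ)) := by
  obtain ⟨σ, h⟩ := exists_equiv_of_lvl (τ := τ) (n := n) (s := s) (n + 1)
    (fun _ => isMax_iff) (fun _ => isMax_iff)
  exact ⟨σ, fun x => ⟨⟨(h x).1.choose⟩, (h x).2⟩⟩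

lemma equalMinDecks : EqualMinDecksWithNbhds (El n s τ) (El n s (!τ)) := by
  obtain ⟨σ, h⟩ := exists_equiv_of_lvl (τ := τ) (n := n) (s := s) 0
    (fun _ => isMin_iff) (fun _ => isMin_iff)
  exact ⟨σ, fun x => ⟨⟨(h x).1.choose⟩, (h x).2⟩⟩

lemma le_card_lvl {b : ℕ} (hb : b ≤ n + 1) {p : El n s τ → Prop}
    (hp : ∀ x, p x ↔ lvl x = 3 * b) : s ≤ Nat.card {x // p x} := by
  let k : Fin s → Idx n s := fun a =>
    (⟨min b n, by omega⟩, ⟨2 * a.val + (b - n), by have := a.isLt; omega⟩)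
  have hk : ∀ a, p (.pin (k a)) := fun a => by
    have := a.isLt
    rw [hp]
    simp only [lvl, pinLvl, k]
    split_ifs <;> omega
  have hinj : Function.Injective fun a => (⟨.pin (k a), hk a⟩ : {x // p x}) := by
    intro a a' h
    simp only [Subtype.mk.injEq, El.pin.injEq, k, Prod.mk.injEq, Fin.mk.injEq] at h
    exact Fin.ext (by omega)
  simpa using Nat.card_le_card_of_injective _ hinj

open Classical in
/-- The Iverson bracket with values in the field with two elements. -/
noncomputable def iv (p : Prop) : ZMod 2 := if p then 1 else 0

lemma iv_true {p : Prop} (h : p) : iv p = 1 := if_pos h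

lemma iv_false {p : Prop} (h : ¬ p) : iv p = 0 := if_neg h

lemma iv_congr {p q : Prop} (h : p ↔ q) : iv p = iv q := by rw [propext h]

lemma iv_mul (p q : Prop) : iv p * iv q = iv (p ∧ q) := by
  by_cases hp : p <;> by_cases hq : q <;> simp [iv, hp, hq]

lemma iv_or {p q : Prop} (h : ¬ (p ∧ q)) : iv (p ∨ q) = iv p + iv q := by
  by_cases hp : p <;> by_cases hq : q <;> simp_all [iv]

lemma sum_iv {ι : Type*} [Fintype ι] {p : ι → Prop} {q : Prop} (a : q → ι)
    (h : ∀ x, p x ↔ ∃ hq : q, x = a hq) : ∑ x, iv (p x) = iv q := by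
  by_cases hq : q
  · rw [iv_true hq, Finset.sum_eq_single (a hq)]
    · exact iv_true ((h _).2 ⟨hq, rfl⟩)
    · exact fun x _ hx => iv_false fun hp => hx ((h x).1 hp).2
    · exact fun hx => absurd (Finset.mem_univ _) hx
  · rw [iv_false hq]
    exact Finset.sum_eq_zero fun x _ => iv_false fun hp => hq ((h x).1 hp).1

/-- Conditions on level and parity of position are met by an even number of pins. -/
lemma sum_iv_pinLvl (q : ℕ → ℕ → Prop) : ∑ k : Idx n s, iv (q (pinLvl k) (k.2.val % 2)) = 0 := by
  let f : Idx n s → Idx n s := fun k =>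
    (k.1, ⟨if k.2.val % 4 < 2 then k.2.val + 2 else k.2.val - 2, by
      have := k.2.isLt; split_ifs <;> omega⟩)
  have hf : ∀ k, (f k).2.val = if k.2.val % 4 < 2 then k.2.val + 2 else k.2.val - 2 :=
    fun k => rfl
  have hp : ∀ k, (f k).2.val % 2 = k.2.val % 2 := fun k => by
    rw [hf]; split_ifs <;> omega
  have hl : ∀ k, pinLvl (f k) = pinLvl k := fun k => by
    have h1 : (f k).1 = k.1 := rfl
    have h2 := hf k
    have := k.2.isLt
    unfold pinLvl
    rw [h1]
    split_ifs at h2 ⊢ <;> omega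
  refine Finset.sum_involution (fun k _ => f k) (fun k _ => ?_) (fun k _ _ h => ?_)
    (fun k _ => Finset.mem_univ _) (fun k _ => ?_)
  · rw [hl, hp]; exact CharTwo.add_self_eq_zero _
  · have := hf k
    rw [h] at this
    split_ifs at this <;> omega
  · refine Prod.ext rfl (Fin.ext ?_)
    have h1 := hf k
    have h2 := hf (f k)
    split_ifs at h1 h2 <;> omega

/-- The first block. -/
def First (k : Idx n s) : Prop := k.1.val = 0 ∧ k.2.val = 0

/-- The last block. -/
def Last (k : Idx n s) : Prop := k.1.val = n ∧ k.2.val = 4 * s + 7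

lemma sum_next {k : Idx n s} (q : ℕ → Prop) :
    ∑ k' : Idx n s, iv (Next k k' ∧ q (k'.2.val % 2)) =
      iv (¬ Last k ∧ q ((k.2.val + 1) % 2)) := by
  have h1 := k.1.isLt
  have h2 := k.2.isLt
  by_cases h : k.2.val = 4 * s + 7
  · refine sum_iv (fun hq => (⟨k.1.val + 1, by have := hq.1; unfold Last at this; omega⟩,
      ⟨0, by omega⟩)) fun k' => ?_
    have h1' := k'.1.isLt
    have hp : (k.2.val + 1) % 2 = 0 := by omega
    rw [hp]
    constructor
    · rintro ⟨hn, hq⟩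
      have hn' : k'.1.val = k.1.val + 1 ∧ k'.2.val = 0 := by
        have := k'.2.isLt; unfold Next at hn; omega
      rw [hn'.2] at hq
      exact ⟨⟨by unfold Last; omega, hq⟩, Prod.ext (Fin.ext hn'.1) (Fin.ext hn'.2)⟩
    · rintro ⟨hq, rfl⟩
      exact ⟨Or.inr ⟨rfl, h, rfl⟩, hq.2⟩
  · refine sum_iv (fun hq => (k.1, ⟨k.2.val + 1, by omega⟩)) fun k' => ?_
    constructor
    · rintro ⟨hn, hq⟩
      have hn' : k'.1.val = k.1.val ∧ k'.2.val = k.2.val + 1 := by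
        unfold Next at hn; omega
      rw [hn'.2] at hq
      exact ⟨⟨by unfold Last; omega, hq⟩, Prod.ext (Fin.ext hn'.1) (Fin.ext hn'.2)⟩
    · rintro ⟨hq, rfl⟩
      exact ⟨Or.inl ⟨rfl, rfl⟩, hq.2⟩

lemma sum_prev {k : Idx n s} (q : ℕ → Prop) :
    ∑ k' : Idx n s, iv (Next k' k ∧ q (k'.2.val % 2)) =
      iv (¬ First k ∧ q ((k.2.val + 1) % 2)) := by
  have h1 := k.1.isLt
  have h2 := k.2.isLt
  by_cases h : k.2.val = 0
  · refine sum_iv (fun hq => (⟨k.1.val - 1, by omega⟩, ⟨4 * s + 7, by omega⟩)) fun k' => ?_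
    have hp : (k.2.val + 1) % 2 = 1 := by omega
    rw [hp]
    constructor
    · rintro ⟨hn, hq⟩
      have hn' : k'.1.val + 1 = k.1.val ∧ k'.2.val = 4 * s + 7 := by
        unfold Next at hn; omega
      have hp' : k'.2.val % 2 = 1 := by omega
      rw [hp'] at hq
      exact ⟨⟨by unfold First; omega, hq⟩,
        Prod.ext (Fin.ext (by simp only; omega)) (Fin.ext hn'.2)⟩
    · rintro ⟨hq, rfl⟩
      have hq1 := hq.1
      have hp' : (4 * s + 7) % 2 = 1 := by omega
      refine ⟨Or.inr ⟨?_, rfl, h⟩, ?_⟩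
      · unfold First at hq1; simp only; omega
      · simp only [hp']; exact hq.2
  · have hp : (k.2.val + 1) % 2 = (k.2.val - 1) % 2 := by omega
    rw [hp]
    refine sum_iv (fun hq => (k.1, ⟨k.2.val - 1, by omega⟩)) fun k' => ?_
    constructor
    · rintro ⟨hn, hq⟩
      have hn' : k'.1.val = k.1.val ∧ k'.2.val = k.2.val - 1 := by
        unfold Next at hn; omega
      rw [hn'.2] at hq
      exact ⟨⟨by unfold First; omega, hq⟩, Prod.ext (Fin.ext hn'.1) (Fin.ext hn'.2)⟩
    · rintro ⟨hq, rfl⟩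
      exact ⟨Or.inl ⟨rfl, by simp only; omega⟩, hq.2⟩

/-- The vector with ones at the pins of positions of parity `ρ` and at one element of every block
at a position of the other parity. -/
noncomputable def vec (ρ : ℕ) : El n s τ → ZMod 2
  | .pin k => iv (k.2.val % 2 = ρ)
  | .blk k i o => iv (i = false ∧ o = false ∧ k.2.val % 2 ≠ ρ)

/-- The levels strictly between the extremal ones that consist of pins only. -/
def Mid (n l : ℕ) : Prop := l % 3 = 0 ∧ 0 < l ∧ l < 3 * n + 3

lemma sum_vec (ρ : ℕ) (p : El n s τ → Prop) :
    ∑ z, iv (p z) * vec ρ z = ∑ k : Idx n s, iv (p (.pin k) ∧ k.2.val % 2 = ρ) +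
      ∑ k : Idx n s, iv (p (.blk k false false) ∧ k.2.val % 2 ≠ ρ) := by
  rw [sum_el]
  simp only [vec, iv_mul, Fintype.sum_bool]
  congr 1
  refine Finset.sum_congr rfl fun k _ => ?_
  have h : ∀ {q r : Prop}, iv (q ∧ true = false ∧ r) = 0 := iv_false (by simp)
  have h' : ∀ {q r : Prop}, iv (q ∧ True ∧ true = false ∧ r) = 0 := iv_false (by simp)
  rw [h, h, h', zero_add, zero_add, zero_add]
  exact iv_congr (by simp)

lemma sum_ex_pin {ρ : ℕ} (hρ : ρ < 2) (k : Idx n s) :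
    ∑ z : El n s τ, iv (Ex (.pin k) z) * vec ρ z =
      iv (τ = true ∧ First k ∧ ρ = 1) + iv (ρ = 0 ∧ Mid n (pinLvl k)) := by
  rw [sum_vec]
  have h0 : ∀ k' : Idx n s, iv (Ex (.pin k : El n s τ) (.pin k') ∧ k'.2.val % 2 = ρ) = 0 :=
    fun k' => iv_false fun h => h.1
  have h1 : ∀ k' : Idx n s, iv (Ex (.pin k : El n s τ) (.blk k' false false) ∧ k'.2.val % 2 ≠ ρ) =
      iv (k' = k ∧ τ = true ∧ First k ∧ ρ = 1) +
        iv (k'.2.val = 4 * s + 7 ∧ k'.1.val < n ∧ pinLvl k = 3 * k'.1.val + 3 ∧ ρ = 0) := by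
    intro k'
    rw [← iv_or]
    · refine iv_congr ?_
      simp only [Ex, PinEx, or_and_right]
      refine or_congr ?_ ?_
      · constructor
        · rintro ⟨⟨rfl, hm⟩, hρ'⟩
          unfold mark at hm
          split_ifs at hm with hf
          · exact ⟨rfl, by simpa using hm, hf, by omega⟩
          · simp at hm
        · rintro ⟨rfl, rfl, hf, rfl⟩
          refine ⟨⟨rfl, ?_⟩, ?_⟩
          · exact if_pos hf
          · rw [hf.2]; decide
      · constructor
        · rintro ⟨⟨h1, h2, h3⟩, h4⟩
          exact ⟨h1, h2, h3, by omega⟩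
        · rintro ⟨h1, h2, h3, h4⟩
          exact ⟨⟨h1, h2, h3⟩, by omega⟩
    · rintro ⟨⟨-, -, -, h⟩, -, -, -, h'⟩
      omega
  simp only [h0, h1, Finset.sum_const_zero, zero_add, Finset.sum_add_distrib]
  congr 1
  · exact sum_iv (fun _ => k) fun k' => by simp [and_comm]
  · refine sum_iv (fun hq => (⟨pinLvl k / 3 - 1, by have := hq.2.2.2; omega⟩,
      ⟨4 * s + 7, by omega⟩)) fun k' => ?_
    constructor
    · rintro ⟨h1, h2, h3, h4⟩
      refine ⟨⟨h4, by omega, by omega, by omega⟩, Prod.ext (Fin.ext ?_) (Fin.ext h1)⟩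
      simp only; omega
    · rintro ⟨⟨h1, h2, h3, h4⟩, rfl⟩
      refine ⟨rfl, ?_, ?_, h1⟩ <;> simp only <;> omega

lemma sum_ex_blk {ρ : ℕ} (hρ : ρ < 2) (k : Idx n s) (i o : Bool) :
    ∑ z : El n s τ, iv (Ex (.blk k i o) z) * vec ρ z = iv (τ = true ∧ First k ∧ ρ = 0) := by
  rw [sum_vec]
  have h0 : ∀ k' : Idx n s, iv (Ex (.blk k i o : El n s τ) (.pin k') ∧ k'.2.val % 2 = ρ) =
      iv (k' = k ∧ mark τ k i o = true ∧ k.2.val % 2 = ρ) +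
        iv (k.2.val = 4 * s + 7 ∧ k.1.val < n ∧ pinLvl k' = 3 * k.1.val + 3 ∧
          k'.2.val % 2 = ρ) := by
    intro k'
    rw [← iv_or]
    · refine iv_congr ?_
      simp only [Ex, PinEx, or_and_right]
      refine or_congr ?_ (by tauto)
      constructor
      · rintro ⟨⟨rfl, hm⟩, hρ'⟩
        exact ⟨rfl, hm, hρ'⟩
      · rintro ⟨rfl, hm, hρ'⟩
        exact ⟨⟨rfl, hm⟩, hρ'⟩
    · rintro ⟨⟨rfl, -⟩, h1, h2, h3, -⟩
      unfold pinLvl at h3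
      split_ifs at h3 <;> omega
  have h1 : ∀ k' : Idx n s,
      iv (Ex (.blk k i o : El n s τ) (.blk k' false false) ∧ k'.2.val % 2 ≠ ρ) =
        iv (Next k k' ∧ o = true ∧ k'.2.val % 2 ≠ ρ) +
          iv (Next k' k ∧ i = true ∧ k'.2.val % 2 ≠ ρ) := by
    intro k'
    rw [← iv_or]
    · refine iv_congr ?_
      simp only [Ex, or_and_right, and_assoc]
      cases i <;> cases o <;> simp
    · rintro ⟨⟨h1, -⟩, h2, -⟩
      unfold Next at h1 h2
      omega
  simp only [h0, h1, Finset.sum_add_distrib]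
  rw [sum_next (fun r => o = true ∧ r ≠ ρ), sum_prev (fun r => i = true ∧ r ≠ ρ),
    sum_iv_pinLvl (fun l r => k.2.val = 4 * s + 7 ∧ k.1.val < n ∧ l = 3 * k.1.val + 3 ∧ r = ρ),
    sum_iv (q := mark τ k i o = true ∧ k.2.val % 2 = ρ) (fun _ => k)
      (fun k' => by simp [and_comm])]
  by_cases hp : k.2.val % 2 = ρ
  · have hp' : (k.2.val + 1) % 2 ≠ ρ := by omega
    by_cases hf : First k
    · have hl : ¬ Last k := by unfold First at hf; unfold Last; omega
      have hm : mark τ k i o = (o ^^ τ) := if_pos hf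
      have hρ0 : ρ = 0 := by rw [← hp, hf.2]
      subst hρ0
      cases o <;> cases τ <;> simp [hf, hl, hm, hp, hp', iv]; decide
    · by_cases hl : Last k
      · have hm : mark τ k i o = i := (if_neg hf).trans (if_pos hl)
        cases i <;> simp [hf, hl, hm, hp, hp', iv]; decide
      · have hm : mark τ k i o = (i ^^ o) := (if_neg hf).trans (if_neg hl)
        cases o <;> cases i <;> simp [hf, hl, hm, hp, hp', iv] <;> decide
  · have hp' : (k.2.val + 1) % 2 = ρ := by omega
    have hf : ¬ (First k ∧ ρ = 0) := by
      rintro ⟨h, h'⟩; exact hp (by rw [h.2, h'])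
    simp [hp, hp', hf, iv]

/-- Solvability of a system of linear equations, an isomorphism invariant that detects the
twist. -/
def Solvable (n s : ℕ) (τ : Bool) : Prop :=
  ∃ T : El n s τ → ZMod 2, (∀ x, ∑ z, iv (Ex x z) * T z = iv (Mid n (lvl x))) ∧
    ∀ z, lvl z = 0 → T z = 1

lemma solvable_false : Solvable n s false := by
  refine ⟨vec 0, fun x => ?_, fun z hz => ?_⟩
  · rcases x with k | ⟨k, i, o⟩
    · rw [sum_ex_pin (by decide)]
      rw [iv_false (by simp), zero_add]
      exact iv_congr (by simp [lvl])
    · rw [sum_ex_blk (by decide), iv_false (by simp), iv_false]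
      rintro ⟨h, -⟩
      simp only [lvl] at h
      omega
  · rcases z with k | ⟨k, i, o⟩
    · refine iv_true ?_
      simp only [lvl, pinLvl] at hz
      split_ifs at hz <;> omega
    · simp only [lvl] at hz
      omega

lemma not_solvable_true : ¬ Solvable n s true := by
  rintro ⟨T, hT, hT1⟩
  let k₀ : Idx n s := (⟨0, by omega⟩, ⟨0, by omega⟩)
  have hk₀ : ∀ k : Idx n s, First k ↔ k = k₀ := fun k =>
    ⟨fun h => Prod.ext (Fin.ext h.1) (Fin.ext h.2), fun h => h ▸ ⟨rfl, rfl⟩⟩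
  have h1 : ∑ x : El n s true, vec 1 x * ∑ z, iv (Ex x z) * T z = 0 := by
    simp only [hT]
    have : ∀ x : El n s true, vec 1 x * iv (Mid n (lvl x)) = iv (Mid n (lvl x)) * vec 1 x :=
      fun x => mul_comm _ _
    simp only [this]
    rw [sum_vec]
    simp only [lvl]
    rw [sum_iv_pinLvl (fun l r => Mid n l ∧ r = 1), zero_add]
    refine Finset.sum_eq_zero fun k _ => iv_false ?_
    rintro ⟨⟨h, -⟩, -⟩
    omega
  have h2 : ∑ x : El n s true, vec 1 x * ∑ z, iv (Ex x z) * T z = T (.pin k₀) := by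
    simp only [Finset.mul_sum]
    rw [Finset.sum_comm]
    have : ∀ z : El n s true, ∑ x, vec 1 x * (iv (Ex x z) * T z) =
        (∑ x, iv (Ex z x) * vec 1 x) * T z := fun z => by
      rw [Finset.sum_mul]
      refine Finset.sum_congr rfl fun x _ => ?_
      rw [iv_congr (ex_comm (x := x) (y := z))]
      ring
    simp only [this]
    rw [Finset.sum_eq_single (.pin k₀)]
    · rw [sum_ex_pin (by decide), iv_true ⟨rfl, (hk₀ _).2 rfl, rfl⟩, iv_false (by simp)]
      simp
    · intro z _ hz
      rcases z with k | ⟨k, i, o⟩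
      · rw [sum_ex_pin (by decide), iv_false, iv_false (by simp), zero_add, zero_mul]
        rintro ⟨-, h, -⟩
        exact hz (congrArg _ ((hk₀ k).1 h))
      · rw [sum_ex_blk (by decide), iv_false (by simp), zero_mul]
    · exact fun h => absurd (Finset.mem_univ _) h
  have h3 : T (.pin k₀) = 1 := hT1 _ (by simp [lvl, pinLvl, k₀])
  rw [← h2, h1] at h3
  exact zero_ne_one h3

lemma lvl_orderIso {τ' : Bool} (Φ : El n s τ ≃o El n s τ') (x : El n s τ) :
    lvl (Φ x) = lvl x := by
  rw [← height_eq_iff, Order.height_orderIso, height_eq]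

lemma ex_iff {x y : El n s τ} : Ex x y ↔ lvl x ≠ lvl y ∧ ¬ x < y ∧ ¬ y < x := by
  rw [lt_iff, lt_iff]
  constructor
  · intro h
    exact ⟨lvl_ne_of_ex h, fun h' => h'.2 h, fun h' => h'.2 (ex_symm h)⟩
  · rintro ⟨h1, h2, h3⟩
    by_contra h
    rcases h1.lt_or_gt with h' | h'
    · exact h2 ⟨h', h⟩
    · exact h3 ⟨h', fun h'' => h (ex_symm h'')⟩

lemma ex_orderIso {τ' : Bool} (Φ : El n s τ ≃o El n s τ') {x y : El n s τ} :
    Ex (Φ x) (Φ y) ↔ Ex x y := by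
  rw [ex_iff, ex_iff, lvl_orderIso, lvl_orderIso, Φ.lt_iff_lt, Φ.lt_iff_lt]

lemma isEmpty_orderIso : IsEmpty (El n s false ≃o El n s true) := by
  refine ⟨fun Φ => not_solvable_true (n := n) (s := s) ?_⟩
  obtain ⟨T, hT, hT1⟩ := solvable_false (n := n) (s := s)
  refine ⟨fun z => T (Φ.symm z), fun x => ?_, fun z hz => hT1 _ ?_⟩
  · rw [← lvl_orderIso Φ.symm x, ← hT, ← Φ.symm.toEquiv.sum_comp]
    refine Finset.sum_congr rfl fun z _ => ?_
    rw [← iv_congr (ex_orderIso Φ.symm (x := x) (y := z))]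
    rfl
  · rw [lvl_orderIso, hz]

lemma card_div_le_ecr (X Y : FinPoset) {ι : Type} [Fintype ι] (f : ι ↪ X) (g : ι ↪ Y)
    (h : ∀ i, Nonempty (Card X (f i) ≃o Card Y (g i))) :
    (Fintype.card ι : ℝ) / Fintype.card X ≤ ecr X Y := by
  unfold ecr
  gcongr
  refine le_csSup ⟨Fintype.card X, ?_⟩ ⟨(Fintype.equivFin ι).symm.toEmbedding.trans f,
    (Fintype.equivFin ι).symm.toEmbedding.trans g, fun i => h _⟩
  rintro m ⟨f, -⟩
  simpa using Fintype.card_le_of_embedding f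

lemma ecr_le_one (X Y : FinPoset) : ecr X Y ≤ 1 := by
  unfold ecr
  refine div_le_one_of_le₀ ?_ (Nat.cast_nonneg _)
  gcongr
  refine csSup_le' ?_
  rintro m ⟨f, -⟩
  simpa using Fintype.card_le_of_embedding f

/-- The elements as a bundled ordered set. -/
def poset (n s : ℕ) (τ : Bool) : FinPoset := ⟨El n s τ⟩

lemma le_ecr (n s : ℕ) : (1 / 5 : ℝ) ≤ ecr (poset n s false) (poset n s true) := by
  let f (σ : Bool) : Idx n s ↪ El n s σ := ⟨.pin, fun _ _ => El.pin.inj⟩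
  refine le_trans (le_of_eq ?_) (card_div_le_ecr (poset n s false) (poset n s true)
    (f false) (f true) fun k => ⟨cardIso k false⟩)
  have h : Fintype.card (poset n s false) = 5 * Fintype.card (Idx n s) := card_el
  have h0 : (Fintype.card (Idx n s) : ℝ) ≠ 0 :=
    Nat.cast_ne_zero.2 Fintype.card_ne_zero
  rw [h]
  push_cast
  field_simp

lemma not_isMax_and_not_isMin {x : El n s τ} {i : Fin (n + 1)} (hi : 1 ≤ i.val)
    (h : Order.height x = ((3 * i.val : ℕ) : ℕ∞)) : ¬ IsMax x ∧ ¬ IsMin x := by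
  rw [height_eq_iff] at h
  rw [isMax_iff, isMin_iff]
  omega

lemma exists_card_iso {k : ℕ} (h : ∃ x : El n s τ, Order.height x = (k : ℕ∞)) :
    ∃ (x : El n s τ) (y : El n s (!τ)), Order.height x = (k : ℕ∞) ∧ Order.height y = (k : ℕ∞) ∧
      (∃ Φ : Card (El n s τ) x ≃o Card (El n s (!τ)) y,
        ∀ z : Card (El n s τ) x, Order.height (Φ z).val = Order.height z.val) ∧
      Nonempty (Nbhd (El n s τ) x ≃o Nbhd (El n s (!τ)) y) := by
  obtain ⟨x, hx⟩ := h
  obtain ⟨y, -, -, hy, -⟩ := exists_two_pins (s := s) k (height_eq_iff.1 hx ▸ lvl_le x)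
  exact ⟨.pin y, .pin y, height_eq_iff.2 hy, height_eq_iff.2 hy,
    ⟨cardIso y τ, height_cardIso y⟩, nonempty_nbhd_pin_iso y⟩

end FoldedPair

/--
For every sequence `(s n)` of natural numbers there is a sequence of pairs
`(Q1 n, Q2 n)` (for `n ≥ 1`) of finite ordered sets such that: (1) `Q1 n` is not
order-isomorphic to `Q2 n`; (2) they have equal maximal and minimal decks;
(3) there are `n + 1` distinct ranks `r_0, …, r_n` with equal marked rank `r_i` decks,
where the ranks `r_1, …, r_n` contain no maximal and no minimal elements; (4) for each
rank `k` (occurring in `Q1 n`) there are elements of rank `k` in `Q1 n` and `Q2 n`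
whose removal produces order-isomorphic cards via a rank-preserving isomorphism;
(5) in all these deck/card equalities the neighborhoods of the corresponding removed
elements are isomorphic; (6) `liminf_{n→∞} ECR(Q1 n, Q2 n) ≥ 1/10`; (7) for every rank
`k` the rank-`k` neighborhood decks are equal; and (8) `Q1 n` and `Q2 n` have at least
`s n` maximal elements, at least `s n` minimal elements, and at least `s n` elements of
each of the ranks `r_i`.
-/
theorem exists_folded_pairs (s : ℕ → ℕ) :
    ∃ Q1 Q2 : ℕ → FinPoset,
      (∀ n : ℕ, 1 ≤ n →
        IsEmpty (↥(Q1 n) ≃o ↥(Q2 n)) ∧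
        EqualMaxDecksWithNbhds ↥(Q1 n) ↥(Q2 n) ∧
        EqualMinDecksWithNbhds ↥(Q1 n) ↥(Q2 n) ∧
        (∃ r : Fin (n + 1) → ℕ, Function.Injective r ∧
          (∀ i : Fin (n + 1), EqualMarkedRankDecksWithNbhds ↥(Q1 n) ↥(Q2 n) (r i)) ∧
          (∀ i : Fin (n + 1), 1 ≤ (i : ℕ) →
            (∀ x : ↥(Q1 n), Order.height x = (r i : ℕ∞) → ¬ IsMax x ∧ ¬ IsMin x) ∧
            (∀ y : ↥(Q2 n), Order.height y = (r i : ℕ∞) → ¬ IsMax y ∧ ¬ IsMin y)) ∧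
          (∀ i : Fin (n + 1),
            s n ≤ Nat.card {x : ↥(Q1 n) // Order.height x = (r i : ℕ∞)} ∧
            s n ≤ Nat.card {y : ↥(Q2 n) // Order.height y = (r i : ℕ∞)})) ∧
        (∀ k : ℕ, (∃ x : ↥(Q1 n), Order.height x = (k : ℕ∞)) →
          ∃ (x : ↥(Q1 n)) (y : ↥(Q2 n)), Order.height x = (k : ℕ∞) ∧
            Order.height y = (k : ℕ∞) ∧
            (∃ Φ : Card ↥(Q1 n) x ≃o Card ↥(Q2 n) y,
              ∀ z : Card ↥(Q1 n) x, Order.height (Φ z).val = Order.height z.val) ∧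
            Nonempty (Nbhd ↥(Q1 n) x ≃o Nbhd ↥(Q2 n) y)) ∧
        (∀ k : ℕ, EqualRankNbhdDecks ↥(Q1 n) ↥(Q2 n) k) ∧
        s n ≤ Nat.card {x : ↥(Q1 n) // IsMax x} ∧
        s n ≤ Nat.card {x : ↥(Q1 n) // IsMin x} ∧
        s n ≤ Nat.card {y : ↥(Q2 n) // IsMax y} ∧
        s n ≤ Nat.card {y : ↥(Q2 n) // IsMin y}) ∧
      (1 / 10 : ℝ) ≤ Filter.liminf (fun n => ecr (Q1 n) (Q2 n)) Filter.atTop := by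
  open FoldedPair in
  refine ⟨fun n => poset n (s n) false, fun n => poset n (s n) true, fun n _ =>
    ⟨isEmpty_orderIso, equalMaxDecks, equalMinDecks, ⟨fun i => 3 * i.val, ?_, ?_, ?_, ?_⟩,
      fun k => exists_card_iso, equalRankNbhdDecks, ?_, ?_, ?_, ?_⟩, ?_⟩
  · exact fun i j h => Fin.ext (Nat.eq_of_mul_eq_mul_left (by decide) h)
  · exact fun i => equalMarkedRankDecks i.val
  · exact fun i hi => ⟨fun x => not_isMax_and_not_isMin hi, fun x => not_isMax_and_not_isMin hi⟩
  · exact fun i => ⟨le_card_lvl i.isLt.le fun x => height_eq_iff,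
      le_card_lvl i.isLt.le fun x => height_eq_iff⟩
  · exact le_card_lvl le_rfl fun x => isMax_iff
  · exact le_card_lvl (Nat.zero_le _) fun x => isMin_iff
  · exact le_card_lvl le_rfl fun x => isMax_iff
  · exact le_card_lvl (Nat.zero_le _) fun x => isMin_iff
  · refine Filter.le_liminf_of_le ?_ (Filter.Eventually.of_forall fun n =>
      le_trans (by norm_num) (le_ecr n (s n)))
    exact (Filter.isBoundedUnder_of ⟨1, fun n => ecr_le_one _ _⟩).isCoboundedUnder_ge
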